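/- Fix p ≥ 1, N ∈ ℕ with N ≥ 1, and L > 0, and let T : ℝ^N → ℝ be a (Borel measurable) function satisfying |T(ξ) − T(ξ')| ≤ (L/N)·∑_{k=1}^N c_p(ξ^k, ξ'^k)·|ξ^k − ξ'^k| for all ξ, ξ' ∈ ℝ^N. Then for all Borel probability measures P, Q on ℝ with ∫|t|^p dP < ∞ and ∫|t|^p dQ < ∞, d_Prok(P^{⊗N} ∘ T⁻¹, Q^{⊗N} ∘ T⁻¹) ≤ √(L·d_{FM,p}(P,Q)) < ∞, where d_Prok denotes the Lévy–Prokhorov distance and P^{⊗N} ∘ T⁻¹ the pushforward of the product measure P^{⊗N} under T. -/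

import Mathlib

open MeasureTheory
open scoped ENNReal

/-- The local Lipschitz growth constant `c_p(x,y) = max{1,|x|,|y|}^(p−1)`. -/
noncomputable def cp (p x y : ℝ) : ℝ := max 1 (max |x| |y|) ^ (p - 1)

/-- The `p`-th order Fortet–Mourier distance between Borel probability measures on `ℝ`. -/
noncomputable def dFM (p : ℝ) (P Q : Measure ℝ) : ℝ≥0∞ :=
  ⨆ ψ ∈ {ψ : ℝ → ℝ | ∀ x y : ℝ, |ψ x - ψ y| ≤ cp p x y * |x - y|},
    ENNReal.ofReal |∫ x, ψ x ∂P - ∫ x, ψ x ∂Q|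

lemma continuous_of_abs_sub_le_cp {p : ℝ} {ψ : ℝ → ℝ}
    (hψ : ∀ x y : ℝ, |ψ x - ψ y| ≤ cp p x y * |x - y|) : Continuous ψ := by
  rw [continuous_iff_continuousAt]
  intro x
  have hc : Continuous fun y => cp p y x * |y - x| := by
    unfold cp
    refine Continuous.mul (Continuous.rpow_const (by fun_prop) fun y => Or.inl ?_) (by fun_prop)
    exact (lt_of_lt_of_le one_pos (le_max_left _ _)).ne'
  refine tendsto_iff_dist_tendsto_zero.2
    (squeeze_zero (fun _ => dist_nonneg) (fun y => hψ y x) ?_)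
  simpa using hc.tendsto x

lemma cp_mul_abs_le {p : ℝ} (x : ℝ) : cp p x 0 * |x - 0| ≤ 1 + |x| ^ p := by
  have hx := abs_nonneg x
  simp only [cp, abs_zero, sub_zero, max_eq_left hx]
  rcases le_total |x| 1 with h | h
  · rw [max_eq_left h, Real.one_rpow, one_mul]
    have := Real.rpow_nonneg hx p
    linarith
  · rw [max_eq_right h, ← Real.rpow_add_one (by linarith), sub_add_cancel]
    linarith

lemma abs_sub_zero_le_of_abs_sub_le_cp {p : ℝ} {ψ : ℝ → ℝ}
    (hψ : ∀ x y : ℝ, |ψ x - ψ y| ≤ cp p x y * |x - y|) (x : ℝ) :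
    |ψ x - ψ 0| ≤ 1 + |x| ^ p :=
  (hψ x 0).trans (cp_mul_abs_le x)

lemma integrable_sub_zero_of_abs_sub_le_cp {p : ℝ} {ψ : ℝ → ℝ}
    (hψ : ∀ x y : ℝ, |ψ x - ψ y| ≤ cp p x y * |x - y|) {P : Measure ℝ} [IsFiniteMeasure P]
    (hP : Integrable (fun t : ℝ => |t| ^ p) P) : Integrable (fun x => ψ x - ψ 0) P :=
  ((integrable_const (1 : ℝ)).add hP).mono'
    ((continuous_of_abs_sub_le_cp hψ).sub continuous_const).aestronglyMeasurable
    (Filter.Eventually.of_forall (abs_sub_zero_le_of_abs_sub_le_cp hψ))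

lemma integral_eq_integral_sub_zero_add {p : ℝ} {ψ : ℝ → ℝ}
    (hψ : ∀ x y : ℝ, |ψ x - ψ y| ≤ cp p x y * |x - y|) {P : Measure ℝ} [IsProbabilityMeasure P]
    (hP : Integrable (fun t : ℝ => |t| ^ p) P) :
    ∫ x, ψ x ∂P = ∫ x, (ψ x - ψ 0) ∂P + ψ 0 := by
  have h := integral_add (integrable_sub_zero_of_abs_sub_le_cp hψ hP)
    (integrable_const (μ := P) (ψ 0))
  simpa using h

lemma abs_integral_sub_zero_le {p : ℝ} {ψ : ℝ → ℝ}
    (hψ : ∀ x y : ℝ, |ψ x - ψ y| ≤ cp p x y * |x - y|) {P : Measure ℝ} [IsFiniteMeasure P]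
    (hP : Integrable (fun t : ℝ => |t| ^ p) P) :
    |∫ x, (ψ x - ψ 0) ∂P| ≤ ∫ x, (1 + |x| ^ p) ∂P := by
  rw [← Real.norm_eq_abs]
  exact norm_integral_le_of_norm_le (g := fun x => 1 + |x| ^ p)
    ((integrable_const (1 : ℝ)).add hP) (Filter.Eventually.of_forall (abs_sub_zero_le_of_abs_sub_le_cp hψ))

lemma dFM_lt_top {p : ℝ} {P Q : Measure ℝ} [IsProbabilityMeasure P]
    [IsProbabilityMeasure Q] (hP : Integrable (fun t : ℝ => |t| ^ p) P)
    (hQ : Integrable (fun t : ℝ => |t| ^ p) Q) : dFM p P Q < ⊤ := by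
  refine lt_of_le_of_lt (iSup₂_le fun ψ (hψ : ∀ x y : ℝ, |ψ x - ψ y| ≤ cp p x y * |x - y|) => ?_)
    (ENNReal.ofReal_lt_top (r := ∫ x, (1 + |x| ^ p) ∂P + ∫ x, (1 + |x| ^ p) ∂Q))
  refine ENNReal.ofReal_le_ofReal ?_
  rw [integral_eq_integral_sub_zero_add hψ hP, integral_eq_integral_sub_zero_add hψ hQ,
    add_sub_add_right_eq_sub]
  exact (abs_sub _ _).trans
    (add_le_add (abs_integral_sub_zero_le hψ hP) (abs_integral_sub_zero_le hψ hQ))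

lemma dFM_comm (p : ℝ) (P Q : Measure ℝ) : dFM p P Q = dFM p Q P := by
  simp only [dFM, abs_sub_comm]

lemma abs_integral_sub_integral_le_mul_dFM {p : ℝ} {P Q : Measure ℝ} (hd : dFM p P Q ≠ ⊤)
    {C : ℝ} (hC : 0 < C) {h : ℝ → ℝ} (hh : ∀ x y : ℝ, |h x - h y| ≤ C * (cp p x y * |x - y|)) :
    |∫ x, h x ∂P - ∫ x, h x ∂Q| ≤ C * (dFM p P Q).toReal := by
  have hψ : ∀ x y : ℝ, |C⁻¹ * h x - C⁻¹ * h y| ≤ cp p x y * |x - y| := fun x y => by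
    rw [← mul_sub, abs_mul, abs_of_pos (inv_pos.2 hC)]
    exact (inv_mul_le_iff₀ hC).2 (hh x y)
  have hle : ENNReal.ofReal |∫ x, C⁻¹ * h x ∂P - ∫ x, C⁻¹ * h x ∂Q| ≤ dFM p P Q :=
    le_iSup₂ (f := fun (ψ : ℝ → ℝ)
      (_ : ψ ∈ {ψ : ℝ → ℝ | ∀ x y : ℝ, |ψ x - ψ y| ≤ cp p x y * |x - y|}) =>
      ENNReal.ofReal |∫ x, ψ x ∂P - ∫ x, ψ x ∂Q|) (fun x => C⁻¹ * h x) hψ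
  have hle' := (ENNReal.ofReal_le_iff_le_toReal hd).1 hle
  rw [integral_const_mul, integral_const_mul, ← mul_sub, abs_mul, abs_of_pos (inv_pos.2 hC)] at hle'
  exact (inv_mul_le_iff₀ hC).1 hle'

lemma integral_pi_succ_eq {n : ℕ} (P : Measure ℝ) [IsProbabilityMeasure P]
    {g : (Fin (n + 1) → ℝ) → ℝ} (hg : Measurable g) {M : ℝ} (hM : ∀ ξ, |g ξ| ≤ M) :
    ∫ ξ, g ξ ∂(Measure.pi fun _ => P)
      = ∫ x, ∫ ξ, g (Fin.cons x ξ) ∂(Measure.pi fun _ : Fin n => P) ∂P := by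
  have hcons : Measurable fun z : ℝ × (Fin n → ℝ) => (Fin.cons z.1 z.2 : Fin (n + 1) → ℝ) := by
    refine measurable_pi_iff.2 fun i => ?_
    induction i using Fin.cases with
    | zero => simpa using measurable_fst
    | succ i => simpa using! (measurable_pi_apply i).comp measurable_snd
  rw [← ((measurePreserving_piFinSuccAbove (fun _ : Fin (n + 1) => P) 0).symm).integral_comp'
    (g := g)]
  simp only [MeasurableEquiv.piFinSuccAbove_symm_apply, Fin.insertNthEquiv, Equiv.coe_fn_mk,
    Fin.insertNth_zero']
  refine integral_prod (fun z : ℝ × (Fin n → ℝ) => g (Fin.cons z.1 z.2)) ?_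
  exact Integrable.of_bound (hg.comp hcons).aestronglyMeasurable M
    (Filter.Eventually.of_forall fun z => hM _)

/-- A bounded function on a product space that is Lipschitz with respect to the sum of the costs
`c_p(x, y) |x - y|` over the coordinates has integrals against `P^{⊗n}` and `Q^{⊗n}` differing by
at most `n` times the Fortet–Mourier distance, up to the Lipschitz constant. -/
lemma abs_integral_pi_sub_integral_pi_le {p : ℝ} {P Q : Measure ℝ} [IsProbabilityMeasure P]
    [IsProbabilityMeasure Q] (hd : dFM p P Q ≠ ⊤) {C : ℝ} (hC : 0 < C) {M : ℝ} {n : ℕ}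
    {g : (Fin n → ℝ) → ℝ} (hg : Measurable g) (hM : ∀ ξ, |g ξ| ≤ M)
    (hgC : ∀ ξ ξ' : Fin n → ℝ, |g ξ - g ξ'| ≤ C * ∑ k, cp p (ξ k) (ξ' k) * |ξ k - ξ' k|) :
    |∫ ξ, g ξ ∂(Measure.pi fun _ => P) - ∫ ξ, g ξ ∂(Measure.pi fun _ => Q)|
      ≤ C * n * (dFM p P Q).toReal := by
  induction n with
  | zero => simp [Measure.pi_of_empty _ (0 : Fin 0 → ℝ)]
  | succ n ih =>
    have hcons : ∀ x : ℝ, Measurable fun ξ : Fin n → ℝ => (Fin.cons x ξ : Fin (n + 1) → ℝ) := by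
      refine fun x => measurable_pi_iff.2 fun i => ?_
      induction i using Fin.cases with
      | zero => simp
      | succ i => simpa using measurable_pi_apply i
    have hint : ∀ (R : Measure ℝ) [IsProbabilityMeasure R] (x : ℝ),
        Integrable (fun ξ : Fin n → ℝ => g (Fin.cons x ξ)) (Measure.pi fun _ => R) :=
      fun R _ x => Integrable.of_bound (hg.comp (hcons x)).aestronglyMeasurable M
        (Filter.Eventually.of_forall fun z => hM _)
    have hlip : ∀ (R : Measure ℝ) [IsProbabilityMeasure R] (x y : ℝ),
        |∫ ξ, g (Fin.cons x ξ) ∂(Measure.pi fun _ : Fin n => R)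
          - ∫ ξ, g (Fin.cons y ξ) ∂(Measure.pi fun _ : Fin n => R)|
          ≤ C * (cp p x y * |x - y|) := by
      intro R _ x y
      rw [← integral_sub (hint R x) (hint R y), ← Real.norm_eq_abs]
      refine (norm_integral_le_of_norm_le_const (C := C * (cp p x y * |x - y|))
        (Filter.Eventually.of_forall fun ξ => ?_)).trans (by simp)
      simpa [Fin.sum_univ_succ] using hgC (Fin.cons x ξ) (Fin.cons y ξ)
    have hinner : ∀ x : ℝ, |∫ ξ, g (Fin.cons x ξ) ∂(Measure.pi fun _ : Fin n => P)
        - ∫ ξ, g (Fin.cons x ξ) ∂(Measure.pi fun _ : Fin n => Q)|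
        ≤ C * n * (dFM p P Q).toReal := by
      refine fun x => ih (hg.comp (hcons x)) (fun ξ => hM _) fun ξ ξ' => ?_
      simpa [Fin.sum_univ_succ] using hgC (Fin.cons x ξ) (Fin.cons x ξ')
    have hcont : ∀ (R : Measure ℝ) [IsProbabilityMeasure R],
        Continuous fun x => ∫ ξ, g (Fin.cons x ξ) ∂(Measure.pi fun _ : Fin n => R) := by
      intro R _
      have h := continuous_of_abs_sub_le_cp (p := p)
        (ψ := fun x => C⁻¹ * ∫ ξ, g (Fin.cons x ξ) ∂(Measure.pi fun _ : Fin n => R))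
        fun x y => by
          rw [← mul_sub, abs_mul, abs_of_pos (inv_pos.2 hC)]
          exact (inv_mul_le_iff₀ hC).2 (hlip R x y)
      simpa [mul_inv_cancel_left₀ hC.ne'] using h.const_mul C
    have hint' : ∀ (R : Measure ℝ) [IsProbabilityMeasure R],
        Integrable (fun x => ∫ ξ, g (Fin.cons x ξ) ∂(Measure.pi fun _ : Fin n => R)) P := by
      refine fun R _ => Integrable.of_bound (hcont R).aestronglyMeasurable M
        (Filter.Eventually.of_forall fun x => ?_)
      refine (norm_integral_le_of_norm_le_const (C := M)
        (Filter.Eventually.of_forall fun ξ => hM _)).trans (by simp)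
    rw [integral_pi_succ_eq P hg hM, integral_pi_succ_eq Q hg hM]
    refine (abs_sub_le _
      (∫ x, ∫ ξ, g (Fin.cons x ξ) ∂(Measure.pi fun _ : Fin n => Q) ∂P) _).trans ?_
    have h₁ : |∫ x, ∫ ξ, g (Fin.cons x ξ) ∂(Measure.pi fun _ : Fin n => P) ∂P
        - ∫ x, ∫ ξ, g (Fin.cons x ξ) ∂(Measure.pi fun _ : Fin n => Q) ∂P|
        ≤ C * n * (dFM p P Q).toReal := by
      rw [← integral_sub (hint' P) (hint' Q), ← Real.norm_eq_abs]
      exact (norm_integral_le_of_norm_le_const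
        (Filter.Eventually.of_forall hinner)).trans (by simp)
    have h₂ := abs_integral_sub_integral_le_mul_dFM hd hC (hlip Q)
    push_cast
    linarith

lemma measure_le_measure_thickening_add {α : Type*} [PseudoEMetricSpace α] [MeasurableSpace α]
    [BorelSpace α] {μ ν : Measure α} [IsFiniteMeasure μ] [IsFiniteMeasure ν] {δ ε : ℝ}
    (hδ : 0 < δ) (hε : 0 ≤ ε) {B : Set α} (hB : MeasurableSet B)
    (h : ∫ x, (thickenedIndicator hδ B x : ℝ) ∂μ - ∫ x, (thickenedIndicator hδ B x : ℝ) ∂ν ≤ ε) :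
    μ B ≤ ν (Metric.thickening δ B) + ENNReal.ofReal ε := by
  have hcont : Continuous fun x => (thickenedIndicator hδ B x : ℝ) :=
    NNReal.continuous_coe.comp (thickenedIndicator hδ B).continuous
  have hint : ∀ (κ : Measure α) [IsFiniteMeasure κ],
      Integrable (fun x => (thickenedIndicator hδ B x : ℝ)) κ := fun κ _ =>
    Integrable.of_bound hcont.measurable.aestronglyMeasurable 1
      (Filter.Eventually.of_forall fun x => by
        simpa using thickenedIndicator_le_one hδ B x)
  have h₁ : μ.real B ≤ ∫ x, (thickenedIndicator hδ B x : ℝ) ∂μ := by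
    rw [← integral_indicator_one hB]
    refine integral_mono ((integrable_const 1).indicator hB) (hint μ) fun x => ?_
    by_cases hx : x ∈ B
    · simp [hx, thickenedIndicator_one hδ B hx]
    · simp [hx]
  have hm : MeasurableSet (Metric.thickening δ B) := Metric.isOpen_thickening.measurableSet
  have h₂ : ∫ x, (thickenedIndicator hδ B x : ℝ) ∂ν ≤ ν.real (Metric.thickening δ B) := by
    rw [← integral_indicator_one hm]
    refine integral_mono (hint ν) ((integrable_const 1).indicator hm) fun x => ?_
    by_cases hx : x ∈ Metric.thickening δ B
    · simpa [hx] using thickenedIndicator_le_one hδ B x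
    · simp [hx, thickenedIndicator_zero hδ B hx]
  rw [← ofReal_measureReal (μ := μ) (s := B),
    ← ofReal_measureReal (μ := ν) (s := Metric.thickening δ B),
    ← ENNReal.ofReal_add measureReal_nonneg hε]
  exact ENNReal.ofReal_le_ofReal (by linarith)

lemma measure_map_pi_le_measure_thickening_add {p : ℝ} {N : ℕ} (hN : 1 ≤ N) {L : ℝ} (hL : 0 < L)
    {T : (Fin N → ℝ) → ℝ} (hTm : Measurable T)
    (hT : ∀ ξ ξ' : Fin N → ℝ,
      |T ξ - T ξ'| ≤ (L / (N : ℝ)) * ∑ k, cp p (ξ k) (ξ' k) * |ξ k - ξ' k|)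
    {P Q : Measure ℝ} [IsProbabilityMeasure P] [IsProbabilityMeasure Q] (hd : dFM p P Q ≠ ⊤)
    {ε : ℝ} (hε : 0 < ε) (hdε : L * (dFM p P Q).toReal ≤ ε ^ 2) {B : Set ℝ}
    (hB : MeasurableSet B) :
    (Measure.pi fun _ : Fin N => P).map T B
      ≤ (Measure.pi fun _ : Fin N => Q).map T (Metric.thickening ε B) + ENNReal.ofReal ε := by
  have hN' : (0 : ℝ) < N := by exact_mod_cast hN
  have := Measure.isProbabilityMeasure_map (μ := Measure.pi fun _ : Fin N => P) hTm.aemeasurable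
  have := Measure.isProbabilityMeasure_map (μ := Measure.pi fun _ : Fin N => Q) hTm.aemeasurable
  have hm : Measurable fun x => (thickenedIndicator hε B x : ℝ) :=
    (NNReal.continuous_coe.comp (thickenedIndicator hε B).continuous).measurable
  refine measure_le_measure_thickening_add hε hε.le hB ?_
  rw [integral_map hTm.aemeasurable hm.aestronglyMeasurable,
    integral_map hTm.aemeasurable hm.aestronglyMeasurable]
  refine (le_abs_self _).trans ((abs_integral_pi_sub_integral_pi_le hd
    (C := ε⁻¹ * (L / N)) (by positivity) (M := 1) (hm.comp hTm) (fun ξ => ?_)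
    fun ξ ξ' => ?_).trans ?_)
  · simpa using thickenedIndicator_le_one hε B (T ξ)
  · have h := (lipschitzWith_thickenedIndicator hε B).dist_le_mul (T ξ) (T ξ')
    rw [NNReal.dist_eq, Real.dist_eq, NNReal.coe_inv, Real.coe_toNNReal _ hε.le] at h
    rw [mul_assoc]
    exact h.trans (mul_le_mul_of_nonneg_left (hT ξ ξ') (inv_pos.2 hε).le)
  · rw [mul_assoc ε⁻¹, div_mul_cancel₀ _ hN'.ne', mul_assoc, inv_mul_le_iff₀ hε, ← sq]
    exact hdε

/-- Let `p ≥ 1`, `N ≥ 1`, `L > 0`, and `T : ℝ^N → ℝ` be Borel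
measurable with `|T(ξ) − T(ξ')| ≤ (L/N)·∑ c_p(ξ^k, ξ'^k)·|ξ^k − ξ'^k|`. Then for all
probability measures `P, Q` on `ℝ` with finite `p`-th absolute moments,
`d_Prok(P^{⊗N} ∘ T⁻¹, Q^{⊗N} ∘ T⁻¹) ≤ √(L · d_{FM,p}(P,Q)) < ∞`, where `d_Prok` is the
Lévy–Prokhorov distance. -/
theorem quantitative_statistical_robustness_prokhorov (p : ℝ) (hp : 1 ≤ p)
    (N : ℕ) (hN : 1 ≤ N) (L : ℝ) (hL : 0 < L)
    (T : (Fin N → ℝ) → ℝ) (hTm : Measurable T)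
    (hT : ∀ ξ ξ' : Fin N → ℝ,
      |T ξ - T ξ'| ≤ (L / (N : ℝ)) * ∑ k, cp p (ξ k) (ξ' k) * |ξ k - ξ' k|)
    (P Q : Measure ℝ) [IsProbabilityMeasure P] [IsProbabilityMeasure Q]
    (hP : Integrable (fun t : ℝ => |t| ^ p) P) (hQ : Integrable (fun t : ℝ => |t| ^ p) Q) :
    levyProkhorovEDist ((Measure.pi fun _ : Fin N => P).map T)
        ((Measure.pi fun _ : Fin N => Q).map T)
      ≤ (ENNReal.ofReal L * dFM p P Q) ^ (1 / 2 : ℝ) ∧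
      (ENNReal.ofReal L * dFM p P Q) ^ (1 / 2 : ℝ) < ⊤ := by
  have hd := dFM_lt_top hP hQ
  have hfin : (ENNReal.ofReal L * dFM p P Q) ^ (1 / 2 : ℝ) < ⊤ :=
    ENNReal.rpow_lt_top_of_nonneg (by norm_num) (ENNReal.mul_lt_top ENNReal.ofReal_lt_top hd).ne
  refine ⟨levyProkhorovEDist_le_of_forall _ _ _ fun ε B hε hε_top hB => ?_, hfin⟩
  have hε_pos : 0 < ε.toReal := ENNReal.toReal_pos (pos_of_gt hε).ne' hε_top.ne
  have hdε : L * (dFM p P Q).toReal ≤ ε.toReal ^ 2 := by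
    have h : ENNReal.ofReal L * dFM p P Q ≤ ε ^ 2 := by
      have h' := ENNReal.rpow_le_rpow hε.le (zero_le_two (α := ℝ))
      rw [← ENNReal.rpow_mul] at h'
      simpa using h'
    have h' := ENNReal.toReal_mono (ENNReal.pow_ne_top hε_top.ne) h
    rwa [ENNReal.toReal_mul, ENNReal.toReal_ofReal hL.le, ENNReal.toReal_pow] at h'
  have h₁ := measure_map_pi_le_measure_thickening_add hN hL hTm hT hd.ne hε_pos hdε hB
  rw [dFM_comm] at hdε hd
  have h₂ := measure_map_pi_le_measure_thickening_add hN hL hTm hT hd.ne hε_pos hdε hB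
  rw [ENNReal.ofReal_toReal hε_top.ne] at h₁ h₂
  exact ⟨h₁, h₂⟩
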